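/- arXiv:1809.06277 — 5 statements merged into one kernel-verified Lean document; each statement's English description precedes it below -/
import Mathlib

section
/- Let (A_k)_{k≥1} be any sequence of d×d real matrices and (b_k)_{k≥1} any sequence of vectors in ℝ^d, and set Â_n := (1/n) Σ_{k=1}^n A_k. Suppose Â_k is invertible for every 1 ≤ k ≤ n, and let (θ•_k)_{0≤k≤n} satisfy the SNR recursion θ•_k − θ•_{k−1} = −(1/k) Â_k⁻¹ (A_kθ•_{k−1} − b_k) for 1 ≤ k ≤ n. Then θ•_n − θ* = −Â_n⁻¹ (1/n) Σ_{k=1}^n Δ*_k, where Δ*_k := A_kθ* − b_k. -/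
open Matrix Finset

/-- Multiplying the recursion by `Σ_{j=1}^m A_j = m Â_m` makes it telescope. -/
theorem sum_mulVec_sub_eq_neg_sum {d : ℕ} (n : ℕ) (θstar : Fin d → ℝ)
    (A : ℕ → Matrix (Fin d) (Fin d) ℝ) (b : ℕ → Fin d → ℝ) (θ : ℕ → Fin d → ℝ)
    (hstep : ∀ k : ℕ, k < n →
      (∑ j ∈ Icc 1 (k + 1), A j) *ᵥ (θ (k + 1) - θ k) = -(A (k + 1) *ᵥ θ k - b (k + 1)))
    (m : ℕ) (hm : m ≤ n) :
    (∑ j ∈ Icc 1 m, A j) *ᵥ (θ m - θstar) = -∑ k ∈ Icc 1 m, (A k *ᵥ θstar - b k) := by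
  induction m with
  | zero => simp
  | succ m ih =>
    have hm' := ih (by omega)
    rw [← sub_add_sub_cancel (θ (m + 1)) (θ m) θstar, mulVec_add, hstep m (by omega),
      sum_Icc_succ_top (by omega), sum_Icc_succ_top (by omega), add_mulVec, hm', mulVec_sub]
    abel

/-- For the SNR recursion with matrix gain `Â_k⁻¹`, where
`Â_k = (1/k) Σ_{j=1}^k A_j` is invertible for `1 ≤ k ≤ n`, one has
`θ•_n − θ* = −Â_n⁻¹ (1/n) Σ_{k=1}^n Δ*_k` with `Δ*_k = A_kθ* − b_k`. -/
theorem stmt_1 {d : ℕ} (hd : 1 ≤ d) (n : ℕ) (hn : 1 ≤ n)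
    (θstar : Fin d → ℝ)
    (Aseq : ℕ → Matrix (Fin d) (Fin d) ℝ) (bseq : ℕ → Fin d → ℝ)
    (Ahat : ℕ → Matrix (Fin d) (Fin d) ℝ)
    (hAhat : ∀ k : ℕ, 1 ≤ k →
      Ahat k = ((1 : ℝ) / k) • ∑ j ∈ Finset.Icc 1 k, Aseq j)
    (hinv : ∀ k : ℕ, 1 ≤ k → k ≤ n → IsUnit (Ahat k).det)
    (θ : ℕ → Fin d → ℝ)
    (hrec : ∀ k : ℕ, 1 ≤ k → k ≤ n →
      θ k - θ (k - 1) =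
        -(((1 : ℝ) / k) • ((Ahat k)⁻¹ *ᵥ (Aseq k *ᵥ θ (k - 1) - bseq k)))) :
    θ n - θstar =
      -((Ahat n)⁻¹ *ᵥ (((1 : ℝ) / n) •
        ∑ k ∈ Finset.Icc 1 n, (Aseq k *ᵥ θstar - bseq k))) := by
  have hmul : ∀ k : ℕ, 1 ≤ k → ∑ j ∈ Icc 1 k, Aseq j = (k : ℝ) • Ahat k := by
    intro k hk
    have hk0 : (k : ℝ) ≠ 0 := by positivity
    rw [hAhat k hk, smul_smul, mul_one_div_cancel hk0, one_smul]
  have hn0 : (n : ℝ) ≠ 0 := by positivity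
  have key := sum_mulVec_sub_eq_neg_sum n θstar Aseq bseq θ (fun k hk => by
    have hk0 : ((k + 1 : ℕ) : ℝ) ≠ 0 := by positivity
    have h := hrec (k + 1) (by omega) (by omega)
    rw [Nat.add_sub_cancel] at h
    rw [h, hmul (k + 1) (by omega), mulVec_neg, mulVec_smul, smul_mulVec, mulVec_mulVec,
      mul_nonsing_inv _ (hinv (k + 1) (by omega) (by omega)), one_mulVec, smul_smul,
      one_div_mul_cancel hk0, one_smul]) n le_rfl
  rw [hmul n hn, smul_mulVec] at key
  rw [← mulVec_neg, ← smul_neg, ← key, smul_smul, one_div_mul_cancel hn0, one_smul,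
    mulVec_mulVec, nonsing_inv_mul _ (hinv n hn le_rfl), one_mulVec]
end

section
/- Under (A1)–(A2) and invertibility of A, the simplified SNR iterates converge: θ*_n → θ* almost surely as n → ∞. -/
open MeasureTheory Matrix Filter Topology

/-- **Kronecker's lemma** for weights `n`, phrased for a running average `x`. -/
lemma tendsto_zero_of_running_average {x D : ℕ → ℝ} {l : ℝ}
    (hx : ∀ n : ℕ, (n + 1 : ℝ) * x (n + 1) = n * x n + D n)
    (hD : Tendsto (fun n => ∑ k ∈ Finset.range n, D k / (k + 1 : ℝ)) atTop (𝓝 l)) :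
    Tendsto x atTop (𝓝 0) := by
  set M : ℕ → ℝ := fun n => ∑ k ∈ Finset.range n, D k / (k + 1 : ℝ) with hM
  have key : ∀ n : ℕ, (n : ℝ) * x n = n * M n - ∑ k ∈ Finset.range n, M k := by
    intro n
    induction n with
    | zero => simp
    | succ n ih =>
      have h1 : M (n + 1) = M n + D n / (n + 1 : ℝ) := Finset.sum_range_succ _ _
      have h2 : (n + 1 : ℝ) * (D n / (n + 1 : ℝ)) = D n := by field_simp
      rw [Finset.sum_range_succ, h1]
      push_cast
      rw [hx n, ih]
      linear_combination -h2
  have hlim := hD.sub hD.cesaro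
  rw [sub_self] at hlim
  refine hlim.congr' ?_
  filter_upwards [eventually_gt_atTop 0] with n hn
  have hn' : (n : ℝ) ≠ 0 := by positivity
  have := key n
  change M n - (n : ℝ)⁻¹ * ∑ k ∈ Finset.range n, M k = x n
  field_simp
  linarith

/-- A nonnegative sequence with `u (n + 1) ≤ u n + a n * (1 + u n)` and `∑ a n < ∞` is bounded. -/
lemma exists_bound_of_summable_perturbation {u a : ℕ → ℝ} (hu : ∀ n, 0 ≤ u n)
    (ha : ∀ n, 0 ≤ a n) (hs : Summable a) (h : ∀ n, u (n + 1) ≤ u n + a n * (1 + u n)) :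
    ∃ B, ∀ n, u n ≤ B := by
  have key : ∀ n, 1 + u n ≤ (1 + u 0) * Real.exp (∑ k ∈ Finset.range n, a k) := by
    intro n
    induction n with
    | zero => simp
    | succ n ih =>
      have h1 : 1 + a n ≤ Real.exp (a n) := by linarith [Real.add_one_le_exp (a n)]
      rw [Finset.sum_range_succ, Real.exp_add, ← mul_assoc]
      calc 1 + u (n + 1) ≤ (1 + u n) * (1 + a n) := by linarith [h n]
        _ ≤ _ := mul_le_mul ih h1 (by linarith [ha n])
          (mul_nonneg (by linarith [hu 0]) (Real.exp_pos _).le)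
  refine ⟨(1 + u 0) * Real.exp (∑' k, a k), fun n => ?_⟩
  have h2 : Real.exp (∑ k ∈ Finset.range n, a k) ≤ Real.exp (∑' k, a k) :=
    Real.exp_le_exp.2 (hs.sum_le_tsum _ fun i _ => ha i)
  have h3 := mul_le_mul_of_nonneg_left h2 (by linarith [hu 0] : 0 ≤ 1 + u 0)
  linarith [key n]

section MartingaleDifferences

variable {Ω : Type*} {m0 : MeasurableSpace Ω} {μ : Measure Ω} [IsProbabilityMeasure μ]

lemma integral_mul_eq_zero_of_condExp_eq_zero {m : MeasurableSpace Ω} (hm : m ≤ m0)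
    {Y X : Ω → ℝ} (hY : StronglyMeasurable[m] Y) (hY2 : MemLp Y 2 μ) (hX2 : MemLp X 2 μ)
    (hX : μ[X | m] =ᵐ[μ] 0) : ∫ ω, Y ω * X ω ∂μ = 0 := by
  have h1 : μ[Y * X | m] =ᵐ[μ] Y * μ[X | m] :=
    condExp_mul_of_stronglyMeasurable_left hY (hY2.integrable_mul hX2)
      (hX2.integrable (by norm_num))
  have h2 : μ[Y * X | m] =ᵐ[μ] 0 := by
    filter_upwards [h1, hX] with ω h h'
    simp [h, h']
  have h3 : ∫ ω, (μ[Y * X | m]) ω ∂μ = ∫ ω, (Y * X) ω ∂μ := integral_condExp hm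
  rw [integral_congr_ae h2] at h3
  simpa using h3.symm

lemma integral_add_sq_of_condExp_eq_zero {m : MeasurableSpace Ω} (hm : m ≤ m0)
    {Y X : Ω → ℝ} (hY : StronglyMeasurable[m] Y) (hY2 : MemLp Y 2 μ) (hX2 : MemLp X 2 μ)
    (hX : μ[X | m] =ᵐ[μ] 0) :
    ∫ ω, (Y ω + X ω) ^ 2 ∂μ = ∫ ω, Y ω ^ 2 ∂μ + ∫ ω, X ω ^ 2 ∂μ := by
  have h0 := integral_mul_eq_zero_of_condExp_eq_zero hm hY hY2 hX2 hX
  have hi : Integrable (fun ω => 2 * (Y ω * X ω)) μ := (hY2.integrable_mul hX2).const_mul 2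
  have h1 : ∀ ω, (Y ω + X ω) ^ 2 = Y ω ^ 2 + 2 * (Y ω * X ω) + X ω ^ 2 := fun ω => by ring
  have hi' : Integrable (fun ω => Y ω ^ 2 + 2 * (Y ω * X ω)) μ := hY2.integrable_sq.add hi
  simp_rw [h1]
  rw [integral_add hi' hX2.integrable_sq, integral_add hY2.integrable_sq hi, integral_const_mul, h0]
  ring

/-- A series of square-integrable martingale differences with summable variances converges a.s. -/
lemma ae_exists_tendsto_sum_of_summable_variance {ℱ : Filtration ℕ m0} {ξ : ℕ → Ω → ℝ}
    (hm : ∀ n, StronglyMeasurable[ℱ (n + 1)] (ξ n)) (hL : ∀ n, MemLp (ξ n) 2 μ)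
    (hc : ∀ n, μ[ξ n | ℱ n] =ᵐ[μ] 0) (hs : Summable fun n => ∫ ω, ξ n ω ^ 2 ∂μ) :
    ∀ᵐ ω ∂μ, ∃ l, Tendsto (fun n => ∑ k ∈ Finset.range n, ξ k ω) atTop (𝓝 l) := by
  set M : ℕ → Ω → ℝ := fun n ω => ∑ k ∈ Finset.range n, ξ k ω with hM
  have hMsucc : ∀ n ω, M (n + 1) ω = M n ω + ξ n ω := fun n ω => Finset.sum_range_succ _ _
  have hMm : ∀ n, StronglyMeasurable[ℱ n] (M n) := fun n =>
    Finset.stronglyMeasurable_fun_sum _ fun k hk =>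
      (hm k).mono (ℱ.mono (Finset.mem_range.1 hk))
  have hML : ∀ n, MemLp (M n) 2 μ := fun n => memLp_finsetSum _ fun k _ => hL k
  have hmart : Martingale M ℱ μ := by
    refine martingale_of_condExp_sub_eq_zero_nat hMm
      (fun n => (hML n).integrable (by norm_num)) fun n => ?_
    have : M (n + 1) - M n = ξ n := by
      ext ω
      simp [hMsucc]
    rw [this]
    exact hc n
  have hM2 : ∀ n, ∫ ω, M n ω ^ 2 ∂μ = ∑ k ∈ Finset.range n, ∫ ω, ξ k ω ^ 2 ∂μ := by
    intro n
    induction n with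
    | zero => simp [hM]
    | succ n ih =>
      simp_rw [hMsucc]
      rw [integral_add_sq_of_condExp_eq_zero (ℱ.le n) (hMm n) (hML n) (hL n) (hc n), ih,
        Finset.sum_range_succ]
  refine hmart.submartingale.exists_ae_tendsto_of_bdd
    (R := (1 + ∑' n, ∫ ω, ξ n ω ^ 2 ∂μ).toNNReal) fun n => ?_
  have hint : Integrable (M n) μ := (hML n).integrable (by norm_num)
  rw [eLpNorm_one_eq_lintegral_enorm, ← ofReal_integral_norm_eq_lintegral_enorm hint]
  refine ENNReal.ofReal_le_ofReal ?_
  calc ∫ ω, ‖M n ω‖ ∂μ ≤ ∫ ω, (1 + M n ω ^ 2) ∂μ := by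
        refine integral_mono hint.norm ((integrable_const 1).add (hML n).integrable_sq) fun ω => ?_
        change |M n ω| ≤ 1 + M n ω ^ 2
        nlinarith [sq_abs (M n ω), sq_nonneg (|M n ω| - 1), abs_nonneg (M n ω)]
    _ = 1 + ∑ k ∈ Finset.range n, ∫ ω, ξ k ω ^ 2 ∂μ := by
        rw [integral_add (integrable_const 1) (hML n).integrable_sq, hM2]
        simp
    _ ≤ _ := by
        gcongr
        exact hs.sum_le_tsum _ fun k _ => integral_nonneg fun ω => sq_nonneg _

/-- A vector-valued running average of martingale differences whose size is controlled by the
average itself tends to zero a.s. -/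
lemma ae_tendsto_zero_of_running_average {ι : Type*} [Fintype ι] {ℱ : Filtration ℕ m0}
    {e D : ℕ → Ω → ι → ℝ} {K : ℝ}
    (hrec : ∀ (n : ℕ) ω i, (n + 1 : ℝ) * e (n + 1) ω i = n * e n ω i + D n ω i)
    (hem : ∀ n i, StronglyMeasurable[ℱ n] fun ω => e n ω i)
    (he0 : ∀ i, MemLp (fun ω => e 0 ω i) 2 μ)
    (hc : ∀ n i, μ[fun ω => D n ω i | ℱ n] =ᵐ[μ] 0)
    (hK : 0 ≤ K) (hD : ∀ n ω i, D n ω i ^ 2 ≤ K * (1 + ∑ j, e n ω j ^ 2)) :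
    ∀ᵐ ω ∂μ, Tendsto (fun n => e n ω) atTop (𝓝 0) := by
  have hDeq : ∀ n i, (fun ω => D n ω i) =
      fun ω => (n + 1 : ℝ) * e (n + 1) ω i - n * e n ω i := fun n i => by
    ext ω
    rw [hrec]
    ring
  have hDm : ∀ n i, StronglyMeasurable[ℱ (n + 1)] fun ω => D n ω i := fun n i => by
    rw [hDeq]
    exact ((hem (n + 1) i).const_mul _).sub (((hem n i).mono (ℱ.mono n.le_succ)).const_mul _)
  have hsum : ∀ n, (∀ i, MemLp (fun ω => e n ω i) 2 μ) →
      Integrable (fun ω => K * (1 + ∑ j, e n ω j ^ 2)) μ := fun n h =>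
    ((integrable_const 1).add (integrable_finsetSum _ fun j _ => (h j).integrable_sq)).const_mul K
  have hDL_of : ∀ n i, (∀ i, MemLp (fun ω => e n ω i) 2 μ) →
      MemLp (fun ω => D n ω i) 2 μ := fun n i h => by
    have hDm' := ((hDm n i).mono (ℱ.le _)).aestronglyMeasurable (μ := μ)
    refine (memLp_two_iff_integrable_sq hDm').2 ((hsum n h).mono' (hDm'.pow 2) ?_)
    filter_upwards with ω
    rw [Real.norm_eq_abs, abs_of_nonneg (sq_nonneg _)]
    exact hD n ω i
  have heL : ∀ n i, MemLp (fun ω => e n ω i) 2 μ := fun n => by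
    induction n with
    | zero => exact he0
    | succ n ih =>
      intro i
      have h : (fun ω => e (n + 1) ω i) =
          fun ω => (n + 1 : ℝ)⁻¹ * (n * e n ω i + D n ω i) := by
        ext ω
        rw [← hrec]
        field_simp
      rw [h]
      exact (((ih i).const_mul _).add (hDL_of n i ih)).const_mul _
  have hDL : ∀ n i, MemLp (fun ω => D n ω i) 2 μ := fun n i => hDL_of n i (heL n)
  set u : ℕ → ℝ := fun n => ∑ i, ∫ ω, e n ω i ^ 2 ∂μ with hu
  have hu0 : ∀ n, 0 ≤ u n := fun n =>
    Finset.sum_nonneg fun i _ => integral_nonneg fun ω => sq_nonneg _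
  have hDu : ∀ n i, ∫ ω, D n ω i ^ 2 ∂μ ≤ K * (1 + u n) := fun n i => by
    have hsq : Integrable (fun ω => ∑ j, e n ω j ^ 2) μ :=
      integrable_finsetSum _ fun j _ => (heL n j).integrable_sq
    calc ∫ ω, D n ω i ^ 2 ∂μ ≤ ∫ ω, K * (1 + ∑ j, e n ω j ^ 2) ∂μ :=
          integral_mono (hDL n i).integrable_sq (hsum n (heL n)) fun ω => hD n ω i
      _ = K * (1 + u n) := by
          rw [integral_const_mul, integral_add (integrable_const 1) hsq,
            integral_finsetSum _ fun j _ => (heL n j).integrable_sq]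
          simp [hu]
  have hstep : ∀ (n : ℕ) i, (n + 1 : ℝ) ^ 2 * ∫ ω, e (n + 1) ω i ^ 2 ∂μ =
      (n : ℝ) ^ 2 * ∫ ω, e n ω i ^ 2 ∂μ + ∫ ω, D n ω i ^ 2 ∂μ := fun n i => by
    have h := integral_add_sq_of_condExp_eq_zero (ℱ.le n) ((hem n i).const_mul (n : ℝ))
      ((heL n i).const_mul (n : ℝ)) (hDL n i) (hc n i)
    simp_rw [← hrec, mul_pow, integral_const_mul] at h
    exact h
  have hsumm : Summable fun n : ℕ => 1 / ((n : ℝ) + 1) ^ 2 := by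
    have := (summable_nat_add_iff 1).2 (Real.summable_one_div_nat_pow.2 one_lt_two)
    simpa using this
  set N : ℝ := (Fintype.card ι : ℝ) with hN
  have hN0 : 0 ≤ N := Nat.cast_nonneg _
  obtain ⟨B, hB⟩ : ∃ B, ∀ n, u n ≤ B := by
    refine exists_bound_of_summable_perturbation (a := fun n => N * K * (1 / ((n : ℝ) + 1) ^ 2))
      hu0 (fun n => by positivity) (hsumm.mul_left _) fun n => ?_
    have h1 : ((n : ℝ) + 1) ^ 2 * u (n + 1) ≤ (n : ℝ) ^ 2 * u n + N * (K * (1 + u n)) := by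
      rw [hu]
      simp only [Finset.mul_sum]
      simp_rw [hstep]
      rw [Finset.sum_add_distrib]
      gcongr
      calc ∑ i, ∫ ω, D n ω i ^ 2 ∂μ ≤ ∑ _i : ι, K * (1 + u n) :=
            Finset.sum_le_sum fun i _ => hDu n i
        _ = N * (K * (1 + u n)) := by simp [hN]
    have h2 : (n : ℝ) ^ 2 * u n ≤ ((n : ℝ) + 1) ^ 2 * u n :=
      mul_le_mul_of_nonneg_right (by gcongr; linarith) (hu0 n)
    have h3 : (0 : ℝ) < ((n : ℝ) + 1) ^ 2 := by positivity
    refine le_of_mul_le_mul_left (h1.trans ?_) h3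
    have h4 : ((n : ℝ) + 1) ^ 2 * (u n + N * K * (1 / ((n : ℝ) + 1) ^ 2) * (1 + u n)) =
        ((n : ℝ) + 1) ^ 2 * u n + N * (K * (1 + u n)) := by
      field_simp
    linarith
  have hconv : ∀ i, ∀ᵐ ω ∂μ, ∃ l,
      Tendsto (fun n => ∑ k ∈ Finset.range n, D k ω i / (k + 1 : ℝ)) atTop (𝓝 l) := by
    intro i
    refine ae_exists_tendsto_sum_of_summable_variance (ℱ := ℱ)
      (ξ := fun n ω => D n ω i / (n + 1 : ℝ)) (fun n => ?_) (fun n => ?_) (fun n => ?_) ?_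
    · simp_rw [div_eq_mul_inv]
      exact (hDm n i).mul_const _
    · simp_rw [div_eq_mul_inv]
      exact (hDL n i).mul_const _
    · have h : (fun ω => D n ω i / (n + 1 : ℝ)) = (n + 1 : ℝ)⁻¹ • fun ω => D n ω i := by
        ext ω
        simp [div_eq_inv_mul]
      rw [h]
      filter_upwards [condExp_smul (μ := μ) (n + 1 : ℝ)⁻¹ (fun ω => D n ω i) (ℱ n), hc n i]
        with ω h1 h2
      simp [h1, h2]
    · refine Summable.of_nonneg_of_le (fun n => integral_nonneg fun ω => sq_nonneg _)
        (fun n => ?_) (hsumm.mul_left (K * (1 + B)))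
      simp_rw [div_pow]
      rw [integral_div, mul_one_div]
      gcongr
      exact (hDu n i).trans (by gcongr; exact hB n)
  filter_upwards [ae_all_iff.2 hconv] with ω hω
  refine tendsto_pi_nhds.2 fun i => ?_
  obtain ⟨l, hl⟩ := hω i
  exact tendsto_zero_of_running_average (fun n => hrec n ω i) hl

end MartingaleDifferences

lemma abs_mulVec_sub_mulVec_le {ι : Type*} [Fintype ι] (G N : Matrix ι ι ℝ) (β v : ι → ℝ)
    {C : ℝ} (hN : ∀ i j, |N i j| ≤ C) (hβ : ∀ i, |β i| ≤ C) (i : ι) :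
    |(G *ᵥ (β - N *ᵥ v)) i| ≤ (∑ j, |G i j|) * (C * (1 + ∑ k, |v k|)) := by
  simp only [mulVec, dotProduct, Pi.sub_apply]
  rw [Finset.sum_mul]
  refine (Finset.abs_sum_le_sum_abs _ _).trans (Finset.sum_le_sum fun j _ => ?_)
  rw [abs_mul]
  gcongr
  refine (abs_sub _ _).trans ?_
  rw [mul_add, mul_one, Finset.mul_sum]
  refine add_le_add (hβ j) ((Finset.abs_sum_le_sum_abs _ _).trans
    (Finset.sum_le_sum fun k _ => ?_))
  rw [abs_mul]
  gcongr
  exact hN j k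

/-- Quadratic growth of the noise `G (β - N v)` in the deviation of `v` from a fixed vector. -/
lemma exists_sq_mulVec_sub_mulVec_le {ι : Type*} [Fintype ι] (G : Matrix ι ι ℝ) (t : ι → ℝ)
    (C : ℝ) : ∃ K, 0 ≤ K ∧ ∀ (N : Matrix ι ι ℝ) (β v : ι → ℝ), (∀ i j, |N i j| ≤ C) →
      (∀ i, |β i| ≤ C) → ∀ i, (G *ᵥ (β - N *ᵥ v)) i ^ 2 ≤ K * (1 + ∑ j, (v j - t j) ^ 2) := by
  set g : ℝ := ∑ i, ∑ j, |G i j| with hg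
  set T : ℝ := 1 + ∑ k, |t k| with hT
  refine ⟨(g * C) ^ 2 * (2 * T ^ 2 + 2 * Fintype.card ι), by positivity,
    fun N β v hN hβ i => ?_⟩
  have hC : 0 ≤ C := (abs_nonneg _).trans (hβ i)
  have hgi : ∑ j, |G i j| ≤ g :=
    Finset.single_le_sum (f := fun i => ∑ j, |G i j|)
      (fun i _ => Finset.sum_nonneg fun j _ => abs_nonneg _) (Finset.mem_univ i)
  have hg0 : 0 ≤ g := (Finset.sum_nonneg fun j _ => abs_nonneg _).trans hgi
  set S : ℝ := ∑ k, |v k - t k| with hS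
  set Q : ℝ := ∑ k, (v k - t k) ^ 2 with hQ
  have hQ0 : 0 ≤ Q := Finset.sum_nonneg fun k _ => sq_nonneg _
  have hv : 1 + ∑ k, |v k| ≤ T + S := by
    have : ∑ k, |v k| ≤ ∑ k, (|t k| + |v k - t k|) := Finset.sum_le_sum fun k _ => by
      simpa using abs_add_le (t k) (v k - t k)
    rw [Finset.sum_add_distrib] at this
    linarith
  have hSQ : S ^ 2 ≤ Fintype.card ι * Q := by
    simpa [sq_abs] using
      sq_sum_le_card_mul_sum_sq (s := Finset.univ) (f := fun k => |v k - t k|)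
  have h1 : |(G *ᵥ (β - N *ᵥ v)) i| ≤ g * C * (T + S) := by
    refine (abs_mulVec_sub_mulVec_le G N β v hN hβ i).trans ?_
    rw [← mul_assoc]
    gcongr
  have h2 : (T + S) ^ 2 ≤ (2 * T ^ 2 + 2 * Fintype.card ι) * (1 + Q) := by
    have h3 : 0 ≤ T ^ 2 * Q := by positivity
    have h4 : (0 : ℝ) ≤ Fintype.card ι := Nat.cast_nonneg _
    nlinarith [sq_nonneg (T - S)]
  calc (G *ᵥ (β - N *ᵥ v)) i ^ 2 = |(G *ᵥ (β - N *ᵥ v)) i| ^ 2 := (sq_abs _).symm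
    _ ≤ (g * C * (T + S)) ^ 2 := by gcongr
    _ = (g * C) ^ 2 * (T + S) ^ 2 := by ring
    _ ≤ (g * C) ^ 2 * ((2 * T ^ 2 + 2 * Fintype.card ι) * (1 + Q)) := by gcongr
    _ = _ := by ring

/-- A linear combination of martingale differences with bounded predictable coefficients has
zero conditional expectation. -/
lemma condExp_mulVec_sub_mulVec_eq_zero {ι Ω : Type*} [Fintype ι] {m m0 : MeasurableSpace Ω}
    {μ : Measure Ω} [IsProbabilityMeasure μ] (hm : m ≤ m0) (G : Matrix ι ι ℝ)
    {N : Ω → Matrix ι ι ℝ} {β v : Ω → ι → ℝ} {R : ℝ}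
    (hv : ∀ k, StronglyMeasurable[m] fun ω => v ω k) (hvR : ∀ ω k, |v ω k| ≤ R)
    (hN : ∀ j k, Integrable (fun ω => N ω j k) μ) (hβ : ∀ j, Integrable (fun ω => β ω j) μ)
    (hN0 : ∀ j k, μ[fun ω => N ω j k | m] =ᵐ[μ] 0) (hβ0 : ∀ j, μ[fun ω => β ω j | m] =ᵐ[μ] 0)
    (i : ι) : μ[fun ω => (G *ᵥ (β ω - N ω *ᵥ v ω)) i | m] =ᵐ[μ] 0 := by
  have hbound : ∀ k, ∀ᵐ ω ∂μ, ‖v ω k‖ ≤ R := fun k => ae_of_all _ fun ω => hvR ω k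
  have hvN : ∀ j k, Integrable ((fun ω => v ω k) * fun ω => N ω j k) μ := fun j k =>
    (hN j k).bdd_mul ((hv k).mono hm).aestronglyMeasurable (hbound k)
  have hvN0 : ∀ j k, μ[(fun ω => v ω k) * fun ω => N ω j k | m] =ᵐ[μ] 0 := fun j k => by
    filter_upwards [condExp_mul_of_stronglyMeasurable_left (hv k) (hvN j k) (hN j k), hN0 j k]
      with ω h h'
    simp [h, h']
  have hfun : (fun ω => (G *ᵥ (β ω - N ω *ᵥ v ω)) i) =
      ∑ j, G i j • ((fun ω => β ω j) - ∑ k, (fun ω => v ω k) * fun ω => N ω j k) := by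
    ext ω
    simp [mulVec, dotProduct, mul_comm (v ω _)]
  have hsum : ∀ j, Integrable (∑ k, (fun ω => v ω k) * fun ω => N ω j k) μ := fun j =>
    integrable_finsetSum' _ fun k _ => hvN j k
  have hterm : ∀ j, μ[G i j • ((fun ω => β ω j) - ∑ k, (fun ω => v ω k) * fun ω => N ω j k) | m]
      =ᵐ[μ] 0 := fun j => by
    filter_upwards [condExp_smul (μ := μ) (G i j)
        ((fun ω => β ω j) - ∑ k, (fun ω => v ω k) * fun ω => N ω j k) m,
      condExp_sub (hβ j) (hsum j) m, condExp_finsetSum (s := Finset.univ) (fun k _ => hvN j k) m,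
      hβ0 j, ae_all_iff.2 (hvN0 j)] with ω h1 h2 h3 h4 h5
    rw [h1, Pi.smul_apply, h2, Pi.sub_apply, h3, h4, Finset.sum_apply,
      Finset.sum_eq_zero fun k _ => h5 k]
    simp
  rw [hfun]
  filter_upwards [condExp_finsetSum (s := Finset.univ)
      (fun j _ => ((hβ j).sub (hsum j)).smul (G i j)) m, ae_all_iff.2 hterm] with ω h1 h2
  rw [h1, Finset.sum_apply, Finset.sum_eq_zero fun j _ => h2 j]
  rfl

/-- Under (A1)–(A2) and invertibility of `A`, the simplified
SNR iterates `θ*_{n+1} − θ*_n = −α_{n+1} A⁻¹ (A_{n+1}θ*_n − b_{n+1})`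
(`α_n = 1/n`) converge almost surely to `θ* = A⁻¹b`. -/
theorem stmt_2 {d : ℕ} (hd : 1 ≤ d)
    {Ω : Type*} {m0 : MeasurableSpace Ω} (μ : Measure Ω) [IsProbabilityMeasure μ]
    (ℱ : Filtration ℕ m0)
    (A : Matrix (Fin d) (Fin d) ℝ) (hA : IsUnit A.det) (b : Fin d → ℝ)
    (Aseq : ℕ → Ω → Matrix (Fin d) (Fin d) ℝ) (bseq : ℕ → Ω → Fin d → ℝ)
    -- adapted
    (hadaptA : ∀ n, StronglyMeasurable[ℱ n] (Aseq n))
    (hadaptb : ∀ n, StronglyMeasurable[ℱ n] (bseq n))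
    -- (A1): common mean (A, b)
    (hmeanA : ∀ n, 1 ≤ n → ∀ i j, ∫ ω, Aseq n ω i j ∂μ = A i j)
    (hmeanb : ∀ n, 1 ≤ n → ∫ ω, bseq n ω ∂μ = b)
    -- (A2): uniformly bounded martingale difference sequences
    (hbdd : ∃ C : ℝ, ∀ n ω, (∀ i j, |Aseq n ω i j - A i j| ≤ C) ∧ ‖bseq n ω - b‖ ≤ C)
    (hmdsA : ∀ n, ∀ i j, μ[fun ω => Aseq (n + 1) ω i j - A i j | ℱ n] =ᵐ[μ] 0)
    (hmdsb : ∀ n, ∀ i, μ[fun ω => bseq (n + 1) ω i - b i | ℱ n] =ᵐ[μ] 0)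
    -- simplified SNR iterates, deterministic initial condition
    (θs : ℕ → Ω → Fin d → ℝ) (θ0 : Fin d → ℝ)
    (hθ0 : ∀ ω, θs 0 ω = θ0)
    (hrec : ∀ n ω,
      θs (n + 1) ω - θs n ω =
        -(((1 : ℝ) / (n + 1)) •
          (A⁻¹ *ᵥ (Aseq (n + 1) ω *ᵥ θs n ω - bseq (n + 1) ω)))) :
    ∀ᵐ ω ∂μ, Tendsto (fun n => θs n ω) atTop (𝓝 (A⁻¹ *ᵥ b)) := by
  obtain ⟨C, hC⟩ := hbdd
  set t : Fin d → ℝ := A⁻¹ *ᵥ b with ht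
  obtain ⟨K, hK, hKD⟩ := exists_sq_mulVec_sub_mulVec_le A⁻¹ t C
  set e : ℕ → Ω → Fin d → ℝ := fun n ω => θs n ω - t with he
  set D : ℕ → Ω → Fin d → ℝ := fun n ω =>
    A⁻¹ *ᵥ ((bseq (n + 1) ω - b) - (Aseq (n + 1) ω - A) *ᵥ θs n ω) with hDdef
  have hbC : ∀ n ω i, |bseq n ω i - b i| ≤ C := fun n ω i =>
    (norm_le_pi_norm (bseq n ω - b) i).trans (hC n ω).2
  have hstep : ∀ (n : ℕ) ω i, (n + 1 : ℝ) * e (n + 1) ω i = n * e n ω i + D n ω i := by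
    intro n ω i
    have hD : D n ω = A⁻¹ *ᵥ bseq (n + 1) ω - t - A⁻¹ *ᵥ (Aseq (n + 1) ω *ᵥ θs n ω)
        + θs n ω := by
      simp only [hDdef, mulVec_sub, sub_mulVec, mulVec_mulVec, nonsing_inv_mul A hA, one_mulVec]
      abel
    have h := congrFun (hrec n ω) i
    simp only [mulVec_sub, Pi.sub_apply, Pi.neg_apply, Pi.smul_apply, smul_eq_mul] at h
    rw [hD]
    simp only [he, Pi.sub_apply, Pi.add_apply]
    have hn : (n + 1 : ℝ) * (1 / (n + 1)) = 1 := by field_simp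
    linear_combination (n + 1 : ℝ) * h - ((A⁻¹ *ᵥ (Aseq (n + 1) ω *ᵥ θs n ω)) i
      - (A⁻¹ *ᵥ bseq (n + 1) ω) i) * hn
  have hDsq : ∀ n ω i, D n ω i ^ 2 ≤ K * (1 + ∑ j, e n ω j ^ 2) := fun n ω i =>
    hKD _ _ _ (fun i j => (hC (n + 1) ω).1 i j) (fun i => hbC (n + 1) ω i) i
  have hAm : ∀ n i j, StronglyMeasurable[ℱ n] fun ω => Aseq n ω i j := fun n i j =>
    (continuous_apply_apply i j).comp_stronglyMeasurable (hadaptA n)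
  have hbm : ∀ n i, StronglyMeasurable[ℱ n] fun ω => bseq n ω i := fun n i =>
    (continuous_apply i).comp_stronglyMeasurable (hadaptb n)
  have hθm : ∀ (m : MeasurableSpace Ω) n k, StronglyMeasurable[m] (fun ω => e n ω k) →
      StronglyMeasurable[m] fun ω => θs n ω k := fun m n k h => by
    have h' : (fun ω => θs n ω k) = fun ω => e n ω k + t k := by
      ext ω
      simp [he]
    rw [h']
    exact h.add stronglyMeasurable_const
  have hem : ∀ n i, StronglyMeasurable[ℱ n] fun ω => e n ω i := by
    intro n
    induction n with
    | zero =>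
      intro i
      simp only [he, hθ0]
      exact stronglyMeasurable_const
    | succ n ih =>
      intro i
      have ih' : ∀ k, StronglyMeasurable[ℱ (n + 1)] fun ω => e n ω k := fun k =>
        (ih k).mono (ℱ.mono n.le_succ)
      have hθ : ∀ k, StronglyMeasurable[ℱ (n + 1)] fun ω => θs n ω k := fun k => hθm _ n k (ih' k)
      have hDm : StronglyMeasurable[ℱ (n + 1)] fun ω => D n ω i := by
        simp only [hDdef, mulVec, dotProduct, Pi.sub_apply, Matrix.sub_apply]
        exact Finset.stronglyMeasurable_fun_sum _ fun j _ =>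
          (((hbm (n + 1) j).sub stronglyMeasurable_const).sub
            (Finset.stronglyMeasurable_fun_sum _ fun k _ =>
              ((hAm (n + 1) j k).sub stronglyMeasurable_const).mul (hθ k))).const_mul _
      have h : (fun ω => e (n + 1) ω i) =
          fun ω => (n + 1 : ℝ)⁻¹ * (n * e n ω i + D n ω i) := by
        ext ω
        rw [← hstep]
        field_simp
      rw [h]
      exact (((ih' i).const_mul _).add hDm).const_mul _
  have hbound : ∀ n, ∃ R, ∀ ω i, |e n ω i| ≤ R := by
    intro n
    induction n with
    | zero => exact ⟨‖θ0 - t‖, fun ω i => by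
        simpa [he, hθ0] using norm_le_pi_norm (θ0 - t) i⟩
    | succ n ih =>
      obtain ⟨R, hR⟩ := ih
      refine ⟨n * R + √(K * (1 + ∑ _j : Fin d, R ^ 2)), fun ω i => ?_⟩
      have hDR : |D n ω i| ≤ √(K * (1 + ∑ _j : Fin d, R ^ 2)) := by
        refine Real.abs_le_sqrt ((hDsq n ω i).trans ?_)
        gcongr K * (1 + ∑ j, ?_) with j
        exact sq_le_sq' (abs_le.1 (hR ω j)).1 (abs_le.1 (hR ω j)).2
      calc |e (n + 1) ω i| ≤ (n + 1 : ℝ) * |e (n + 1) ω i| :=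
            le_mul_of_one_le_left (abs_nonneg _) (by simp)
        _ = |n * e n ω i + D n ω i| := by
            rw [← hstep, abs_mul, abs_of_nonneg (by positivity : (0 : ℝ) ≤ n + 1)]
        _ ≤ |n * e n ω i| + |D n ω i| := abs_add_le _ _
        _ ≤ _ := by
            rw [abs_mul, Nat.abs_cast]
            gcongr
            exact hR ω i
  have hc : ∀ n i, μ[fun ω => D n ω i | ℱ n] =ᵐ[μ] 0 := by
    intro n i
    obtain ⟨R, hR⟩ := hbound n
    refine condExp_mulVec_sub_mulVec_eq_zero (ℱ.le n) A⁻¹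
      (N := fun ω => Aseq (n + 1) ω - A) (β := fun ω => bseq (n + 1) ω - b) (v := θs n)
      (R := R + ‖t‖) (fun k => ?_) (fun ω k => ?_) (fun j k => ?_) (fun j => ?_)
      (hmdsA n) (hmdsb n) i
    · exact hθm _ n k (hem n k)
    · have h := abs_add_le (e n ω k) (t k)
      have h' : e n ω k + t k = θs n ω k := by simp [he]
      rw [h'] at h
      exact h.trans (add_le_add (hR ω k) (norm_le_pi_norm t k))
    · exact Integrable.of_bound
        (((hAm (n + 1) j k).mono (ℱ.le _)).aestronglyMeasurable.sub aestronglyMeasurable_const) C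
        (ae_of_all _ fun ω => (hC (n + 1) ω).1 j k)
    · exact Integrable.of_bound
        (((hbm (n + 1) j).mono (ℱ.le _)).aestronglyMeasurable.sub aestronglyMeasurable_const) C
        (ae_of_all _ fun ω => hbC (n + 1) ω j)
  have he0 : ∀ i, MemLp (fun ω => e 0 ω i) 2 μ := fun i => by
    simp only [he, hθ0]
    exact memLp_const _
  filter_upwards [ae_tendsto_zero_of_running_average hstep hem he0 hc hK hDsq] with ω hω
  exact tendsto_sub_nhds_zero_iff.1 hω
end

section
/- In the setting of the deterministic (A_n ≡ A) simplified SNR and PolSA recursions with common initial conditions, the difference sequence θ̄_n := θ_n − θ*_n satisfies Δθ̄_{n+1} = (I+A)Δθ̄_n + α_{n+1}Aθ̄_n − 𝓔_{n+1} for all n ≥ 0, where 𝓔_{n+1} := (I+A)(Δθ*_{n+1} − Δθ*_n). Moreover, if the sequences (θ*_n) and (Δ_n) are bounded, then there is a constant b_𝓔 < ∞ such that (i) ‖n𝓔_n‖ ≤ b_𝓔 for all n ≥ 1, and (ii) the partial sums S^𝓔_n := Σ_{k=1}^n k𝓔_k satisfy ‖S^𝓔_n‖ ≤ b_𝓔 for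 all n ≥ 1. -/
open Matrix Finset

theorem Matrix.exists_norm_mulVec_le {d : ℕ} (M : Matrix (Fin d) (Fin d) ℝ) :
    ∃ K : ℝ, 0 ≤ K ∧ ∀ v : Fin d → ℝ, ‖M *ᵥ v‖ ≤ K * ‖v‖ :=
  ⟨‖LinearMap.toContinuousLinearMap M.mulVecLin‖, norm_nonneg _,
    fun v => (LinearMap.toContinuousLinearMap M.mulVecLin).le_opNorm v⟩

/-- Summation by parts for `∑ k (Δx_k - Δx_{k-1})`, one term at a time. -/
theorem smul_second_difference_eq_sub {E : Type*} [AddCommGroup E] [Module ℝ E]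
    (x : ℕ → E) (n : ℕ) :
    ((n + 1 : ℕ) : ℝ) •
        ((x (n + 1) - x (n + 1 - 1)) - (x (n + 1 - 1) - x (n + 1 - 2))) =
      (((n + 1 : ℕ) : ℝ) • (x (n + 1) - x (n + 1 - 1)) - (x (n + 1 - 1) - x 0)) -
        ((n : ℝ) • (x n - x (n - 1)) - (x (n - 1) - x 0)) := by
  have h : n + 1 - 2 = n - 1 := by omega
  rw [h, Nat.add_sub_cancel]
  push_cast
  module

/-- With `A_n ≡ A`, common initial conditions
`θ_0 = θ_{−1} = θ*_0 = θ*_{−1}` (increments `Δx_n := x_n − x_{n−1}` encoded with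
truncated subtraction on ℕ, so `Δx_0 = 0`), the difference sequence
`θ̄_n := θ_n − θ*_n` satisfies
`Δθ̄_{n+1} = (I+A)Δθ̄_n + α_{n+1}Aθ̄_n − 𝓔_{n+1}` where
`𝓔_{n+1} := (I+A)(Δθ*_{n+1} − Δθ*_n)`.  Moreover, if `(θ*_n)` and
`(Δ_n) = (b − b_n)` are bounded, then there is a constant `b_𝓔` bounding both
`‖n𝓔_n‖` and the partial sums `‖Σ_{k=1}^n k𝓔_k‖` for all `n ≥ 1`. -/
theorem stmt_11 {d : ℕ} (hd : 1 ≤ d)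
    (A : Matrix (Fin d) (Fin d) ℝ) (hA : IsUnit A.det)
    (b : Fin d → ℝ) (bseq : ℕ → Fin d → ℝ)
    (θs θ : ℕ → Fin d → ℝ)
    (hinit : θ 0 = θs 0)
    (hrecS : ∀ n : ℕ,
      θs (n + 1) - θs n =
        -(((1 : ℝ) / (n + 1)) • (A⁻¹ *ᵥ (A *ᵥ θs n - bseq (n + 1)))))
    (hrecP : ∀ n : ℕ,
      θ (n + 1) - θ n =
        (1 + A) *ᵥ (θ n - θ (n - 1)) +
          ((1 : ℝ) / (n + 1)) • (A *ᵥ θ n - bseq (n + 1))) :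
    (∀ n : ℕ,
      (θ (n + 1) - θs (n + 1)) - (θ n - θs n) =
        (1 + A) *ᵥ ((θ n - θs n) - (θ (n - 1) - θs (n - 1))) +
          ((1 : ℝ) / (n + 1)) • (A *ᵥ (θ n - θs n)) -
          (1 + A) *ᵥ ((θs (n + 1) - θs n) - (θs n - θs (n - 1)))) ∧
    ((∃ Cb : ℝ, ∀ n : ℕ, ‖θs n‖ ≤ Cb ∧ ‖b - bseq n‖ ≤ Cb) →
      ∃ bE : ℝ,
        (∀ n : ℕ, 1 ≤ n →
          ‖(n : ℝ) •
            ((1 + A) *ᵥ ((θs n - θs (n - 1)) - (θs (n - 1) - θs (n - 2))))‖ ≤ bE) ∧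
        (∀ n : ℕ, 1 ≤ n →
          ‖∑ k ∈ Finset.Icc 1 n, (k : ℝ) •
            ((1 + A) *ᵥ ((θs k - θs (k - 1)) - (θs (k - 1) - θs (k - 2))))‖ ≤ bE)) := by
  constructor
  · intro n
    have key : A *ᵥ (θs (n + 1) - θs n) =
        -(((1 : ℝ) / (n + 1)) • (A *ᵥ θs n - bseq (n + 1))) := by
      rw [hrecS, mulVec_neg, mulVec_smul, mulVec_mulVec, mul_nonsing_inv _ hA, one_mulVec]
    have hP := hrecP n
    simp only [add_mulVec, one_mulVec, mulVec_sub, smul_sub] at key hP ⊢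
    linear_combination hP + key
  · rintro ⟨C, hC⟩
    obtain ⟨K, hK, hAinv⟩ := A⁻¹.exists_norm_mulVec_le
    obtain ⟨L, hL, hIA⟩ := (1 + A).exists_norm_mulVec_le
    have hC0 : 0 ≤ C := (norm_nonneg _).trans (hC 0).1
    set T : ℕ → Fin d → ℝ := fun n =>
      (n : ℝ) • (θs n - θs (n - 1)) - (θs (n - 1) - θs 0) with hT
    have hT0 : T 0 = 0 := by simp [hT]
    set B : ℝ := (C + K * (‖b‖ + C)) + (C + C) with hB
    have hB0 : 0 ≤ B := by positivity
    have hTB : ∀ n, ‖T n‖ ≤ B := by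
      rintro (_ | n)
      · rwa [hT0, norm_zero]
      · have hD : ((n + 1 : ℕ) : ℝ) • (θs (n + 1) - θs n) =
            A⁻¹ *ᵥ bseq (n + 1) - θs n := by
          have hn : (n : ℝ) + 1 ≠ 0 := by positivity
          rw [hrecS, smul_neg, smul_smul]
          push_cast
          rw [mul_one_div_cancel hn, one_smul, mulVec_sub, mulVec_mulVec,
            nonsing_inv_mul _ hA, one_mulVec, neg_sub]
        have hb : ‖bseq (n + 1)‖ ≤ ‖b‖ + C := by
          have h := norm_sub_le b (b - bseq (n + 1))
          rw [sub_sub_cancel] at h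
          linarith [(hC (n + 1)).2]
        simp only [hT, Nat.add_sub_cancel, hD]
        have h1 := norm_sub_le (A⁻¹ *ᵥ bseq (n + 1) - θs n) (θs n - θs 0)
        have h2 := norm_sub_le (A⁻¹ *ᵥ bseq (n + 1)) (θs n)
        have h3 := norm_sub_le (θs n) (θs 0)
        have h4 := (hAinv (bseq (n + 1))).trans (mul_le_mul_of_nonneg_left hb hK)
        linarith [(hC n).1, (hC 0).1]
    have hstep : ∀ n : ℕ, ((n + 1 : ℕ) : ℝ) •
        ((1 + A) *ᵥ ((θs (n + 1) - θs (n + 1 - 1)) - (θs (n + 1 - 1) - θs (n + 1 - 2)))) =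
        (1 + A) *ᵥ T (n + 1) - (1 + A) *ᵥ T n := by
      intro n
      rw [← mulVec_smul, smul_second_difference_eq_sub θs n, ← mulVec_sub]
    have hbound : ∀ n, ‖(1 + A) *ᵥ T n‖ ≤ L * B := fun n =>
      (hIA _).trans (mul_le_mul_of_nonneg_left (hTB n) hL)
    have hLB : 0 ≤ L * B := mul_nonneg hL hB0
    refine ⟨L * B + L * B, ?_, ?_⟩
    · rintro (_ | n) hn
      · omega
      · rw [hstep]
        exact (norm_sub_le _ _).trans (add_le_add (hbound _) (hbound _))
    · intro n hn
      have hsum : ∑ k ∈ Finset.Icc 1 n, (k : ℝ) •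
          ((1 + A) *ᵥ ((θs k - θs (k - 1)) - (θs (k - 1) - θs (k - 2)))) =
          (1 + A) *ᵥ T n := by
        clear hn
        induction n with
        | zero => simp [hT0]
        | succ n ih =>
          rw [Finset.sum_Icc_succ_top (by omega), ih, hstep, add_sub_cancel]
      rw [hsum]
      linarith [hbound n]
end

section
/- In the setting of the deterministic (A_n ≡ A) simplified SNR and PolSA recursions, the normalized difference sequence ξ_n := n(θ_n − θ*_n) satisfies, for all n ≥ 0, Δξ_{n+1} = (I+A)( Δξ_n + 2(θ̄_n − θ̄_{n−1}) ) − (n+1)𝓔_{n+1}, where θ̄_n := θ_n − θ*_n, Δξ_n := ξ_n − ξ_{n−1}, and 𝓔_{n+1} := (I+A)(Δθ*_{n+1} − Δθ*_n). -/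
open Matrix

/-- In the deterministic (`A_n ≡ A`) setting, with
`θ̄_n := θ_n − θ*_n` and the normalized difference `ξ_n := n θ̄_n` (extended to
`n = −1` by `ξ_{−1} = −θ̄_{−1}`, where `θ̄_{−1} = θ̄_0` since
`θ_{−1} = θ_0` and `θ*_{−1} = θ*_0`), one has, for all `n ≥ 0`,
`Δξ_{n+1} = (I+A)(Δξ_n + 2(θ̄_n − θ̄_{n−1})) − (n+1)𝓔_{n+1}`, where
`𝓔_{n+1} := (I+A)(Δθ*_{n+1} − Δθ*_n)`. -/
theorem stmt_13 {d : ℕ} (hd : 1 ≤ d)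
    (A : Matrix (Fin d) (Fin d) ℝ) (hA : IsUnit A.det)
    (b : Fin d → ℝ) (bseq : ℕ → Fin d → ℝ)
    (θs θ : ℕ → Fin d → ℝ)
    (hrecS : ∀ n : ℕ,
      θs (n + 1) - θs n =
        -(((1 : ℝ) / (n + 1)) • (A⁻¹ *ᵥ (A *ᵥ θs n - bseq (n + 1)))))
    (hrecP : ∀ n : ℕ,
      θ (n + 1) - θ n =
        (1 + A) *ᵥ (θ n - θ (n - 1)) +
          ((1 : ℝ) / (n + 1)) • (A *ᵥ θ n - bseq (n + 1)))
    (ξ : ℤ → Fin d → ℝ)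
    (hξ : ∀ m : ℤ, -1 ≤ m → ξ m = (m : ℝ) • (θ m.toNat - θs m.toNat)) :
    ∀ n : ℕ,
      ξ (n + 1) - ξ n =
        (1 + A) *ᵥ
          ((ξ n - ξ ((n : ℤ) - 1)) +
            (2 : ℝ) • ((θ n - θs n) - (θ (n - 1) - θs (n - 1)))) -
        ((n : ℝ) + 1) •
          ((1 + A) *ᵥ ((θs (n + 1) - θs n) - (θs n - θs (n - 1)))) := by
  intro n
  have hn : (n : ℝ) + 1 ≠ 0 := by positivity
  have hS : ((n : ℝ) + 1) • (A *ᵥ (θs (n + 1) - θs n)) = -(A *ᵥ θs n - bseq (n + 1)) := by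
    rw [hrecS n, mulVec_neg, mulVec_smul, mulVec_mulVec, mul_nonsing_inv A hA, one_mulVec,
      smul_neg, smul_smul, mul_one_div_cancel hn, one_smul]
  have hP : ((n : ℝ) + 1) • (θ (n + 1) - θ n) =
      ((n : ℝ) + 1) • ((1 + A) *ᵥ (θ n - θ (n - 1))) + (A *ᵥ θ n - bseq (n + 1)) := by
    rw [hrecP n, smul_add, smul_smul, mul_one_div_cancel hn, one_smul]
  have hξ_succ : ξ (n + 1) = ((n : ℝ) + 1) • (θ (n + 1) - θs (n + 1)) := by
    simpa using hξ (n + 1) (by lia)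
  have hξ_self : ξ n = (n : ℝ) • (θ n - θs n) := by
    simpa using hξ n (by lia)
  have hξ_pred : ξ ((n : ℤ) - 1) = ((n : ℝ) - 1) • (θ (n - 1) - θs (n - 1)) := by
    simpa using hξ (n - 1) (by lia)
  rw [hξ_succ, hξ_self, hξ_pred]
  simp only [add_mulVec, one_mulVec, mulVec_add, mulVec_sub, mulVec_smul] at hS hP ⊢
  linear_combination (norm := module) hP + hS
end

section
/- Let (A_n, b_n)_{n≥1} be arbitrary sequences of d×d real matrices and vectors in ℝ^d with Ã_n := A_n − A. Let (θ*_n) satisfy the simplified SNR recursion θ*_{n+1} − θ*_n = −α_{n+1} A⁻¹ (A_{n+1}θ*_n − b_{n+1}) with θ*_0 = θ*_{−1}, and (θ_n) the simplified PolSA recursion θ_{n+1} − θ_n = (I+A)(θ_n − θ_{n−1}) + α_{n+1}(A_{n+1}θ_n − b_{n+1}) with θ_0 = θ_{−1}. Then θ̄_n := θ_n − θ*_n satisfies Δθ̄_{n+1} = (I+A)Δθ̄_n + α_{n+1}Aθ̄_n − 𝓔_{n+1} + α_{n+1}Ã_{n+1}θ̄_n, and the normalized sequence ξ_n := nθ̄_n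 satisfies Δξ_{n+1} = (I+A)( Δξ_n + 2Δθ̄_n ) − (n+1)𝓔_{n+1} + Ã_{n+1}θ̄_n for all n ≥ 0, where 𝓔_{n+1} := (I+A)(Δθ*_{n+1} − Δθ*_n). -/
open Matrix

/-- Pathwise coupling identities for general sequences
`(A_n, b_n)`: with `Ã_n := A_n − A`, the simplified SNR iterates `θ*` and
simplified PolSA iterates `θ` (both with `x_0 = x_{−1}`, increments encoded via
truncated subtraction on ℕ) satisfy
`Δθ̄_{n+1} = (I+A)Δθ̄_n + α_{n+1}Aθ̄_n − 𝓔_{n+1} + α_{n+1}Ã_{n+1}θ̄_n`, and the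
normalized sequence `ξ_n := nθ̄_n` (extended by `ξ_{−1} := −θ̄_{−1} = −θ̄_0`)
satisfies `Δξ_{n+1} = (I+A)(Δξ_n + 2Δθ̄_n) − (n+1)𝓔_{n+1} + Ã_{n+1}θ̄_n`
for all `n ≥ 0`, where `θ̄_n := θ_n − θ*_n` and
`𝓔_{n+1} := (I+A)(Δθ*_{n+1} − Δθ*_n)`. -/
theorem stmt_14 {d : ℕ} (hd : 1 ≤ d)
    (A : Matrix (Fin d) (Fin d) ℝ) (hA : IsUnit A.det)
    (b : Fin d → ℝ)
    (Aseq : ℕ → Matrix (Fin d) (Fin d) ℝ) (bseq : ℕ → Fin d → ℝ)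
    (θs θ : ℕ → Fin d → ℝ)
    (hrecS : ∀ n : ℕ,
      θs (n + 1) - θs n =
        -(((1 : ℝ) / (n + 1)) • (A⁻¹ *ᵥ (Aseq (n + 1) *ᵥ θs n - bseq (n + 1)))))
    (hrecP : ∀ n : ℕ,
      θ (n + 1) - θ n =
        (1 + A) *ᵥ (θ n - θ (n - 1)) +
          ((1 : ℝ) / (n + 1)) • (Aseq (n + 1) *ᵥ θ n - bseq (n + 1)))
    (ξ : ℤ → Fin d → ℝ)
    (hξ : ∀ m : ℤ, -1 ≤ m → ξ m = (m : ℝ) • (θ m.toNat - θs m.toNat)) :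
    (∀ n : ℕ,
      (θ (n + 1) - θs (n + 1)) - (θ n - θs n) =
        (1 + A) *ᵥ ((θ n - θs n) - (θ (n - 1) - θs (n - 1))) +
          ((1 : ℝ) / (n + 1)) • (A *ᵥ (θ n - θs n)) -
          (1 + A) *ᵥ ((θs (n + 1) - θs n) - (θs n - θs (n - 1))) +
          ((1 : ℝ) / (n + 1)) • ((Aseq (n + 1) - A) *ᵥ (θ n - θs n))) ∧
    (∀ n : ℕ,
      ξ (n + 1) - ξ n =
        (1 + A) *ᵥ
          ((ξ n - ξ ((n : ℤ) - 1)) +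
            (2 : ℝ) • ((θ n - θs n) - (θ (n - 1) - θs (n - 1)))) -
        ((n : ℝ) + 1) •
          ((1 + A) *ᵥ ((θs (n + 1) - θs n) - (θs n - θs (n - 1)))) +
        (Aseq (n + 1) - A) *ᵥ (θ n - θs n)) := by
  have hA_incr (n : ℕ) : A *ᵥ (θs (n + 1) - θs n) =
      -(((1 : ℝ) / (n + 1)) • (Aseq (n + 1) *ᵥ θs n - bseq (n + 1))) := by
    rw [hrecS n, mulVec_neg, mulVec_smul, mulVec_mulVec, mul_nonsing_inv A hA, one_mulVec]
  have error_rec (n : ℕ) :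
      (θ (n + 1) - θs (n + 1)) - (θ n - θs n) =
        (1 + A) *ᵥ ((θ n - θs n) - (θ (n - 1) - θs (n - 1))) +
          ((1 : ℝ) / (n + 1)) • (A *ᵥ (θ n - θs n)) -
          (1 + A) *ᵥ ((θs (n + 1) - θs n) - (θs n - θs (n - 1))) +
          ((1 : ℝ) / (n + 1)) • ((Aseq (n + 1) - A) *ᵥ (θ n - θs n)) := by
    have hP := hrecP n
    have hS := hA_incr n
    simp only [add_mulVec, sub_mulVec, mulVec_sub, one_mulVec] at hP hS ⊢
    linear_combination (norm := module) hP + hS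
  refine ⟨error_rec, fun n => ?_⟩
  have hn : (n : ℝ) + 1 ≠ 0 := by positivity
  have hsucc : ξ ((n : ℤ) + 1) = ((n : ℝ) + 1) • (θ (n + 1) - θs (n + 1)) := by
    rw [hξ _ (by lia), show ((n : ℤ) + 1).toNat = n + 1 by lia]
    push_cast
    rfl
  have hself : ξ (n : ℤ) = (n : ℝ) • (θ n - θs n) := by
    rw [hξ _ (by lia), Int.toNat_natCast, Int.cast_natCast]
  have hpred : ξ ((n : ℤ) - 1) = ((n : ℝ) - 1) • (θ (n - 1) - θs (n - 1)) := by
    rw [hξ _ (by lia), show ((n : ℤ) - 1).toNat = n - 1 by lia]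
    push_cast
    rfl
  have hscaled := congrArg (fun v => ((n : ℝ) + 1) • v) (error_rec n)
  simp only [smul_add, smul_sub, smul_smul, mul_one_div_cancel hn, one_smul] at hscaled
  rw [hsucc, hself, hpred]
  simp only [add_mulVec, sub_mulVec, mulVec_sub, mulVec_add, mulVec_smul, one_mulVec]
    at hscaled ⊢
  linear_combination (norm := module) hscaled
end
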